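/- Let 0 < α ≤ 1 and let f : ℝ → ℂ be a continuous 1-periodic function with Fourier coefficients c_n = ∫₀¹ f(t) e(−nt) dt satisfying c_0 = 0, and suppose f is Hölder continuous of index β for every 0 < β < α. Then the series f_+(x) = ∑_{n > 0} c_n e(nx) and f_−(x) = ∑_{n < 0} c_n e(nx) each converge uniformly on ℝ to continuous 1-periodic functions which are Hölder continuous of index β for every 0 < β < α. -/

import Mathlib

open Complex Filter Finset

/-- `e x = exp(2 π i x)` -/
noncomputable def e (t : ℝ) : ℂ := Complex.exp (2 * Real.pi * Complex.I * t)

lemma e_add (s t : ℝ) : e (s + t) = e s * e t := by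
  simp only [e, ← Complex.exp_add]; push_cast; ring_nf

lemma e_eq (t : ℝ) : e t = Complex.exp (Complex.I * ((2 * Real.pi * t : ℝ) : ℂ)) := by
  simp only [e]; push_cast; ring_nf

lemma norm_e (t : ℝ) : ‖e t‖ = 1 := by
  rw [e_eq, mul_comm, Complex.norm_exp_ofReal_mul_I]

lemma continuous_e : Continuous e := by unfold e; fun_prop

lemma e_int (n : ℤ) : e n = 1 := by
  rw [e, ← Complex.exp_int_mul_two_pi_mul_I n]; push_cast; ring_nf

lemma e_nat_mul (n : ℕ) (t : ℝ) : e (n * t) = e t ^ n := by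
  rw [e, e, ← Complex.exp_nat_mul]; push_cast; ring_nf

lemma norm_e_sub_one (t : ℝ) : ‖e t - 1‖ = 2 * |Real.sin (Real.pi * t)| := by
  rw [e_eq, Complex.norm_exp_I_mul_ofReal_sub_one, norm_mul, Real.norm_eq_abs, Real.norm_eq_abs,
    abs_two]
  ring_nf

lemma norm_e_sub_one_le (t : ℝ) : ‖e t - 1‖ ≤ 2 * Real.pi * |t| := by
  rw [norm_e_sub_one]
  have := Real.abs_sin_le_abs (x := Real.pi * t)
  rw [abs_mul, abs_of_pos Real.pi_pos] at this
  linarith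

lemma le_norm_e_sub_one {t : ℝ} (h0 : 0 ≤ t) (h1 : t ≤ 1) : 4 * min t (1 - t) ≤ ‖e t - 1‖ := by
  have key : ∀ s : ℝ, 0 ≤ s → s ≤ 1 / 2 → 2 * s ≤ Real.sin (Real.pi * s) := by
    intro s hs0 hs1
    have hpi := Real.pi_pos
    have := Real.mul_le_sin (x := Real.pi * s) (by positivity) (by nlinarith)
    have h2 : 2 / Real.pi * (Real.pi * s) = 2 * s := by field_simp
    linarith
  rw [norm_e_sub_one]
  rcases le_total t (1 / 2) with h | h
  · have h2 := key t h0 h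
    have h3 := le_abs_self (Real.sin (Real.pi * t))
    have := min_le_left t (1 - t)
    linarith
  · have h2 := key (1 - t) (by linarith) (by linarith)
    rw [show Real.pi * (1 - t) = Real.pi - Real.pi * t by ring, Real.sin_pi_sub] at h2
    have h3 := le_abs_self (Real.sin (Real.pi * t))
    have := min_le_right t (1 - t)
    linarith

/-- The sum of the first `N` positive-frequency characters. -/
noncomputable def posKernel (N : ℕ) (t : ℝ) : ℂ := ∑ n ∈ range N, e ((n + 1 : ℕ) * t)

lemma continuous_posKernel (N : ℕ) : Continuous (posKernel N) := by
  unfold posKernel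
  exact continuous_finsetSum _ fun n _ => continuous_e.comp (continuous_const.mul continuous_id)

lemma posKernel_periodic (N : ℕ) : Function.Periodic (posKernel N) 1 := by
  intro t
  refine Finset.sum_congr rfl fun n _ => ?_
  have h := e_int ((n + 1 : ℕ) : ℤ)
  rw [mul_add, mul_one, e_add]
  push_cast at h ⊢
  rw [h, mul_one]

lemma norm_posKernel_le (N : ℕ) (t : ℝ) : ‖posKernel N t‖ ≤ N := by
  refine (norm_sum_le _ _).trans ?_
  simp [norm_e]

lemma norm_posKernel_mul_le (N : ℕ) (t : ℝ) : ‖posKernel N t‖ * ‖e t - 1‖ ≤ 2 := by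
  have h : posKernel N t * (e t - 1) = e t * (e t ^ N - 1) := by
    rw [← geom_sum_mul (e t) N, posKernel, ← mul_assoc, Finset.mul_sum]
    congr 1
    refine Finset.sum_congr rfl fun n _ => ?_
    rw [e_nat_mul, pow_succ']
  rw [← norm_mul, h, norm_mul, norm_e, one_mul]
  refine (norm_sub_le _ _).trans ?_
  rw [norm_pow, norm_e]
  norm_num

lemma norm_posKernel_le_rpow (N : ℕ) {ε t : ℝ} (hε : 0 < ε) (hε1 : ε ≤ 1) (h0 : 0 < t)
    (h1 : t < 1) :
    ‖posKernel N t‖ ≤ (N : ℝ) ^ ε * (t ^ (ε - 1) + (1 - t) ^ (ε - 1)) := by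
  set a := ‖posKernel N t‖ with ha
  have ha0 : 0 ≤ a := norm_nonneg _
  set s := min t (1 - t) with hs
  have hs0 : 0 < s := lt_min h0 (by linarith)
  have h1' : 0 < 1 - t := by linarith
  have h2 : a * (4 * s) ≤ 2 :=
    (mul_le_mul_of_nonneg_left (le_norm_e_sub_one h0.le h1.le) ha0).trans
      (norm_posKernel_mul_le N t)
  have h3 : a ≤ s⁻¹ := by
    rw [← one_div, le_div_iff₀ hs0]; linarith
  have h4 : s ^ (ε - 1) ≤ t ^ (ε - 1) + (1 - t) ^ (ε - 1) := by
    have p1 := Real.rpow_pos_of_pos h0 (ε - 1)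
    have p2 := Real.rpow_pos_of_pos h1' (ε - 1)
    rcases min_choice t (1 - t) with h | h
    · rw [hs, h]; linarith
    · rw [hs, h]; linarith
  calc a = a ^ ε * a ^ (1 - ε) := by
        rw [← Real.rpow_add_of_nonneg ha0 hε.le (by linarith)]; simp
    _ ≤ (N : ℝ) ^ ε * s⁻¹ ^ (1 - ε) := by
        gcongr
        exact norm_posKernel_le N t
    _ = (N : ℝ) ^ ε * s ^ (ε - 1) := by
        rw [Real.inv_rpow hs0.le, ← Real.rpow_neg hs0.le, neg_sub]
    _ ≤ _ := by gcongr

lemma integral_norm_posKernel_le (N : ℕ) {ε : ℝ} (hε : 0 < ε) (hε1 : ε ≤ 1) :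
    ∫ t in (0:ℝ)..1, ‖posKernel N t‖ ≤ 2 / ε * (N : ℝ) ^ ε := by
  have hi : IntervalIntegrable (fun t : ℝ => t ^ (ε - 1)) MeasureTheory.volume 0 1 :=
    intervalIntegral.intervalIntegrable_rpow' (by linarith)
  have hi' : IntervalIntegrable (fun t : ℝ => (1 - t) ^ (ε - 1)) MeasureTheory.volume 0 1 := by
    simpa using (hi.comp_sub_left 1).symm
  have hv : ∫ t in (0:ℝ)..1, t ^ (ε - 1) = 1 / ε := by
    rw [integral_rpow (Or.inl (by linarith))]
    simp [hε.ne']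
  have hv' : ∫ t in (0:ℝ)..1, (1 - t) ^ (ε - 1) = 1 / ε := by
    rw [intervalIntegral.integral_comp_sub_left (fun t : ℝ => t ^ (ε - 1)) 1]
    simpa using hv
  calc ∫ t in (0:ℝ)..1, ‖posKernel N t‖
      ≤ ∫ t in (0:ℝ)..1, (N : ℝ) ^ ε * (t ^ (ε - 1) + (1 - t) ^ (ε - 1)) := by
        refine intervalIntegral.integral_mono_on_of_le_Ioo zero_le_one
          (continuous_posKernel N).norm.continuousOn.intervalIntegrable
          ((hi.add hi').const_mul _) fun t ht => ?_
        exact norm_posKernel_le_rpow N hε hε1 ht.1 ht.2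
    _ = 2 / ε * (N : ℝ) ^ ε := by
        rw [intervalIntegral.integral_const_mul, intervalIntegral.integral_add hi hi', hv, hv']
        ring

/-- The `n`-th Fourier coefficient on `[0, 1]`. -/
noncomputable def coeff (g : ℝ → ℂ) (n : ℤ) : ℂ := ∫ t in (0:ℝ)..1, g t * e (-(n : ℝ) * t)

/-- The positive-frequency part of the `N`-th Fourier partial sum. -/
noncomputable def posSum (g : ℝ → ℂ) (N : ℕ) (x : ℝ) : ℂ :=
  ∑ n ∈ range N, coeff g (n + 1 : ℕ) * e ((n + 1 : ℕ) * x)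

lemma intervalIntegrable_mul_e {g : ℝ → ℂ} (hg : Continuous g) (n : ℤ) :
    IntervalIntegrable (fun t => g t * e (-(n : ℝ) * t)) MeasureTheory.volume 0 1 :=
  (hg.mul (continuous_e.comp (continuous_const.mul continuous_id))).intervalIntegrable _ _

lemma posSum_eq_integral {g : ℝ → ℂ} (hg : Continuous g) (N : ℕ) (x : ℝ) :
    posSum g N x = ∫ t in (0:ℝ)..1, g t * posKernel N (x - t) := by
  simp only [posSum, coeff, posKernel, ← intervalIntegral.integral_mul_const, Finset.mul_sum]
  rw [← intervalIntegral.integral_finsetSum]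
  · refine intervalIntegral.integral_congr fun t _ => ?_
    refine Finset.sum_congr rfl fun n _ => ?_
    rw [mul_assoc, ← e_add]
    push_cast
    ring_nf
  · intro n _
    exact (intervalIntegrable_mul_e hg _).mul_const _

lemma norm_posSum_le {g : ℝ → ℂ} (hg : Continuous g) {A : ℝ} (hA : ∀ t, ‖g t‖ ≤ A)
    {ε : ℝ} (hε : 0 < ε) (hε1 : ε ≤ 1) (N : ℕ) (x : ℝ) :
    ‖posSum g N x‖ ≤ A * (2 / ε * (N : ℝ) ^ ε) := by
  have hA0 : 0 ≤ A := (norm_nonneg _).trans (hA 0)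
  have hk : Continuous fun t => posKernel N (x - t) :=
    (continuous_posKernel N).comp (continuous_const.sub continuous_id)
  rw [posSum_eq_integral hg]
  calc _ ≤ ∫ t in (0:ℝ)..1, ‖g t * posKernel N (x - t)‖ :=
        intervalIntegral.norm_integral_le_integral_norm zero_le_one
    _ ≤ ∫ t in (0:ℝ)..1, A * ‖posKernel N (x - t)‖ := by
        refine intervalIntegral.integral_mono_on zero_le_one
          ((hg.mul hk).norm.intervalIntegrable _ _)
          ((continuous_const.mul hk.norm).intervalIntegrable _ _) fun t _ => ?_
        rw [norm_mul]
        exact mul_le_mul_of_nonneg_right (hA t) (norm_nonneg _)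
    _ = A * ∫ t in (0:ℝ)..1, ‖posKernel N t‖ := by
        rw [intervalIntegral.integral_const_mul,
          intervalIntegral.integral_comp_sub_left (fun t => ‖posKernel N t‖) x]
        have hp : Function.Periodic (fun t => ‖posKernel N t‖) 1 :=
          fun t => by simp only [posKernel_periodic N t]
        have := hp.intervalIntegral_add_eq (x - 1) 0
        rw [sub_add_cancel, zero_add] at this
        rw [sub_zero, this]
    _ ≤ _ := mul_le_mul_of_nonneg_left (integral_norm_posKernel_le N hε hε1) hA0

lemma coeff_translate {g : ℝ → ℂ} (hp : Function.Periodic g 1) (n : ℤ) (h : ℝ) :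
    coeff (fun t => g (t + h)) n = coeff g n * e (n * h) := by
  have hper : Function.Periodic (fun t => g t * e (-(n : ℝ) * t) * e (n * h)) 1 := by
    intro t
    have h1 := e_int (-n)
    push_cast at h1
    simp only [hp t, mul_add, e_add, mul_one, h1]
  have := intervalIntegral.integral_comp_add_right
    (fun t => g t * e (-(n : ℝ) * t) * e (n * h)) h (a := 0) (b := 1)
  have h2 := hper.intervalIntegral_add_eq h 0
  rw [add_comm h 1] at h2
  rw [zero_add] at this h2
  rw [h2] at this
  rw [coeff, coeff, ← intervalIntegral.integral_mul_const, ← this]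
  refine intervalIntegral.integral_congr fun t _ => ?_
  rw [mul_assoc, ← e_add]
  ring_nf

lemma coeff_sub_translate {g : ℝ → ℂ} (hg : Continuous g) (hp : Function.Periodic g 1) (n : ℤ)
    (h : ℝ) : coeff (fun t => g t - g (t + h)) n = coeff g n * (1 - e (n * h)) := by
  have hgh : Continuous fun t => g (t + h) := by fun_prop
  rw [mul_sub, mul_one, ← coeff_translate hp, coeff, coeff, coeff,
    ← intervalIntegral.integral_sub (intervalIntegrable_mul_e hg n)
      (intervalIntegrable_mul_e hgh n)]
  simp only [sub_mul]

lemma norm_posSum_sub_posSum_le {g : ℝ → ℂ} (hg : Continuous g) (hp : Function.Periodic g 1)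
    {C β : ℝ} (hH : ∀ x y, ‖g x - g y‖ ≤ C * |x - y| ^ β)
    {ε : ℝ} (hε : 0 < ε) (hε1 : ε ≤ 1) (N : ℕ) (x y : ℝ) :
    ‖posSum g N x - posSum g N y‖ ≤ C * |x - y| ^ β * (2 / ε * (N : ℝ) ^ ε) := by
  have h : posSum g N x - posSum g N y = posSum (fun t => g t - g (t + (y - x))) N x := by
    simp only [posSum, ← Finset.sum_sub_distrib]
    refine Finset.sum_congr rfl fun n _ => ?_
    rw [coeff_sub_translate hg hp, ← mul_sub, mul_assoc, sub_mul, one_mul, ← e_add]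
    push_cast
    ring_nf
  rw [h]
  refine norm_posSum_le (by fun_prop) (fun t => ?_) hε hε1 N x
  have := hH t (t + (y - x))
  rwa [show t - (t + (y - x)) = x - y by ring] at this

lemma norm_sum_range_mul_le {a z : ℕ → ℂ} {m : ℕ} {P v : ℝ}
    (hz : ∀ k ≤ m, ‖∑ i ∈ range k, z i‖ ≤ P) (ha : ∀ i < m, ‖a i‖ ≤ 1)
    (hv : ∀ i, i + 1 < m → ‖a (i + 1) - a i‖ ≤ v) (hv0 : 0 ≤ v) :
    ‖∑ i ∈ range m, a i * z i‖ ≤ (1 + m * v) * P := by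
  have hP : 0 ≤ P := (norm_nonneg _).trans (hz 0 (Nat.zero_le _))
  rcases Nat.eq_zero_or_pos m with rfl | hm
  · simpa using hP
  have := Finset.sum_range_by_parts a z m
  simp only [smul_eq_mul] at this
  rw [this, add_mul, one_mul]
  refine (norm_sub_le _ _).trans (add_le_add ?_ ?_)
  · rw [norm_mul]
    exact (mul_le_mul (ha _ (by omega)) (hz m le_rfl) (norm_nonneg _) zero_le_one).trans_eq
      (one_mul P)
  · calc _ ≤ ∑ i ∈ range (m - 1), v * P := by
          refine norm_sum_le_of_le _ fun i hi => ?_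
          have := Finset.mem_range.1 hi
          rw [norm_mul]
          exact mul_le_mul (hv i (by omega)) (hz _ (by omega)) (norm_nonneg _) hv0
      _ = ((m - 1 : ℕ) : ℝ) * (v * P) := by simp
      _ ≤ m * v * P := by
          rw [mul_assoc]
          gcongr
          omega

lemma norm_posSum_block_le {g : ℝ → ℂ} (hg : Continuous g) (hp : Function.Periodic g 1)
    {C β : ℝ} (hC : 0 < C) (hβ : 0 < β) (hH : ∀ x y, ‖g x - g y‖ ≤ C * |x - y| ^ β)
    {ε : ℝ} (hε : 0 < ε) (hε1 : ε ≤ 1) {N m : ℕ} (hN : 0 < N) (hm : m ≤ N) (x : ℝ) :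
    ‖posSum g (N + m) x - posSum g N x‖ ≤ 24 * C / ε * (N : ℝ) ^ (ε - β) := by
  have hN' : (0:ℝ) < N := Nat.cast_pos.2 hN
  have hmN : (m : ℝ) ≤ N := Nat.cast_le.2 hm
  set h : ℝ := 1 / (4 * N) with hh
  have hh0 : 0 < h := by positivity
  set G : ℝ → ℂ := fun t => g t - g (t + h) with hG
  have hGc : Continuous G := by fun_prop
  have hGb : ∀ t, ‖G t‖ ≤ C * (N : ℝ) ^ (-β) := by
    intro t
    refine (hH t (t + h)).trans ?_
    rw [sub_add_cancel_left, abs_neg, abs_of_pos hh0, Real.rpow_neg hN'.le,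
      ← Real.inv_rpow hN'.le]
    gcongr
    rw [hh, one_div]
    gcongr
    linarith
  have hGs : ∀ k ≤ 2 * N, ‖posSum G k x‖ ≤ 4 * C / ε * (N : ℝ) ^ (ε - β) := by
    intro k hk
    have hk' : (k : ℝ) ≤ 2 * N := by exact_mod_cast hk
    refine (norm_posSum_le hGc hGb hε hε1 k x).trans ?_
    have h1 : (k : ℝ) ^ ε ≤ 2 * (N : ℝ) ^ ε := by
      calc (k : ℝ) ^ ε ≤ (2 * N) ^ ε := by gcongr
        _ = 2 ^ ε * (N : ℝ) ^ ε := Real.mul_rpow (by norm_num) hN'.le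
        _ ≤ 2 ^ (1:ℝ) * (N : ℝ) ^ ε := by gcongr; norm_num
        _ = _ := by rw [Real.rpow_one]
    calc C * (N : ℝ) ^ (-β) * (2 / ε * (k : ℝ) ^ ε)
        ≤ C * (N : ℝ) ^ (-β) * (2 / ε * (2 * (N : ℝ) ^ ε)) := by gcongr
      _ = 4 * C / ε * ((N : ℝ) ^ ε * (N : ℝ) ^ (-β)) := by ring
      _ = _ := by rw [← Real.rpow_add hN', sub_eq_add_neg]
  set θ : ℕ → ℝ := fun i => ((N + i + 1 : ℕ) : ℝ) * h with hθ
  have hθlow : ∀ i < m, 1 ≤ ‖e (θ i) - 1‖ := by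
    intro i hi
    have hi' : (i : ℝ) + 1 ≤ N := by exact_mod_cast (by omega : i + 1 ≤ N)
    have h1 : 1 / 4 ≤ θ i := by
      simp only [hθ, hh]; push_cast
      rw [mul_one_div, div_le_div_iff₀ (by norm_num) (by positivity)]
      nlinarith [(Nat.cast_nonneg i : (0:ℝ) ≤ i)]
    have h2 : θ i ≤ 1 / 2 := by
      simp only [hθ, hh]; push_cast
      rw [mul_one_div, div_le_div_iff₀ (by positivity) (by norm_num)]
      nlinarith
    refine le_trans ?_ (le_norm_e_sub_one (by linarith) (by linarith))
    have : 1 / 4 ≤ min (θ i) (1 - θ i) := le_min h1 (by linarith)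
    linarith
  have hne : ∀ i < m, (1 - e (θ i)) ≠ 0 := by
    intro i hi h0
    have := hθlow i hi
    rw [norm_sub_rev, h0, norm_zero] at this
    linarith
  have key := norm_sum_range_mul_le (m := m) (a := fun i => (1 - e (θ i))⁻¹)
    (z := fun i => coeff G (N + i + 1 : ℕ) * e ((N + i + 1 : ℕ) * x))
    (P := 8 * C / ε * (N : ℝ) ^ (ε - β)) (v := 2 / N) ?_ ?_ ?_ (by positivity)
  · have e1 : posSum g (N + m) x - posSum g N x = ∑ i ∈ range m, (1 - e (θ i))⁻¹ *
        (coeff G (N + i + 1 : ℕ) * e ((N + i + 1 : ℕ) * x)) := by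
      rw [posSum, posSum, Finset.sum_range_add, add_sub_cancel_left]
      refine Finset.sum_congr rfl fun i hi => ?_
      have := hne i (Finset.mem_range.1 hi)
      rw [hG, coeff_sub_translate hg hp, Int.cast_natCast]
      change _ = (1 - e (θ i))⁻¹ * (_ * (1 - e (θ i)) * _)
      field_simp
    rw [e1]
    refine key.trans ?_
    have : (1 + (m : ℝ) * (2 / N)) ≤ 3 := by
      have : (m : ℝ) * (2 / N) ≤ 2 := by
        rw [mul_div_assoc', div_le_iff₀ hN']; linarith
      linarith
    calc _ ≤ 3 * (8 * C / ε * (N : ℝ) ^ (ε - β)) := by gcongr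
      _ = _ := by ring
  · intro k hk
    have e2 : ∑ i ∈ range k, coeff G (N + i + 1 : ℕ) * e ((N + i + 1 : ℕ) * x)
        = posSum G (N + k) x - posSum G N x := by
      rw [posSum, posSum, Finset.sum_range_add, add_sub_cancel_left]
    rw [e2]
    refine (norm_sub_le _ _).trans ((add_le_add (hGs _ (by omega)) (hGs _ (by omega))).trans_eq ?_)
    ring
  · intro i hi
    rw [norm_inv, norm_sub_rev]
    exact inv_le_one_of_one_le₀ (hθlow i hi)
  · intro i hi
    have n1 := hne i (by omega)
    have n2 := hne (i + 1) hi
    have b1 := hθlow i (by omega)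
    have b2 := hθlow (i + 1) hi
    have e3 : (1 - e (θ (i + 1)))⁻¹ - (1 - e (θ i))⁻¹
        = e (θ i) * (e h - 1) * ((1 - e (θ (i + 1)))⁻¹ * (1 - e (θ i))⁻¹) := by
      have : e (θ (i + 1)) = e (θ i) * e h := by
        rw [← e_add]; simp only [hθ]; push_cast; ring_nf
      rw [inv_sub_inv n2 n1, this, div_eq_mul_inv, mul_inv]
      ring
    rw [e3, norm_mul, norm_mul, norm_e, one_mul, norm_mul, norm_inv, norm_inv, norm_sub_rev 1,
      norm_sub_rev 1]
    have i1 := inv_le_one_of_one_le₀ b1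
    have i2 := inv_le_one_of_one_le₀ b2
    have i3 : ‖e h - 1‖ ≤ 2 / N := by
      refine (norm_e_sub_one_le h).trans ?_
      rw [abs_of_pos hh0, hh, mul_one_div, div_le_div_iff₀ (by positivity) hN']
      nlinarith [Real.pi_le_four]
    calc _ ≤ 2 / (N : ℝ) * (1 * 1) := by gcongr
      _ = _ := by ring

lemma norm_posSum_tail_le {g : ℝ → ℂ} (hg : Continuous g) (hp : Function.Periodic g 1)
    {C β : ℝ} (hC : 0 < C) (hβ : 0 < β) (hH : ∀ x y, ‖g x - g y‖ ≤ C * |x - y| ^ β)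
    {ε : ℝ} (hε : 0 < ε) (hε1 : ε ≤ 1) (hεβ : ε < β) :
    ∃ K > 0, ∀ (N : ℕ), 0 < N → ∀ M, N ≤ M → ∀ x,
      ‖posSum g M x - posSum g N x‖ ≤ K * (N : ℝ) ^ (ε - β) := by
  set r : ℝ := 2 ^ (ε - β) with hr
  have hr0 : 0 < r := by positivity
  have hr1 : r < 1 := Real.rpow_lt_one_of_one_lt_of_neg (by norm_num) (by linarith)
  have h1r : 0 < 1 - r := by linarith
  refine ⟨24 * C / ε / (1 - r), by positivity, ?_⟩
  set B := 24 * C / ε with hB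
  have hB0 : 0 < B := by positivity
  suffices H : ∀ d N : ℕ, 0 < N → ∀ x,
      ‖posSum g (N + d) x - posSum g N x‖ ≤ B / (1 - r) * (N : ℝ) ^ (ε - β) by
    intro N hN M hM x
    obtain ⟨d, rfl⟩ := Nat.exists_eq_add_of_le hM
    exact H d N hN x
  intro d
  induction d using Nat.strong_induction_on with
  | _ d ih =>
    intro N hN x
    rcases le_total d N with hd | hd
    · refine (norm_posSum_block_le hg hp hC hβ hH hε hε1 hN hd x).trans ?_
      refine mul_le_mul_of_nonneg_right ?_ (by positivity)
      rw [le_div_iff₀ h1r]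
      nlinarith
    · have h1 := ih (d - N) (by omega) (N + N) (by omega) x
      have h2 := norm_posSum_block_le hg hp hC hβ hH hε hε1 hN le_rfl x
      rw [show N + N + (d - N) = N + d by omega] at h1
      have h3 : (((N + N : ℕ) : ℝ)) ^ (ε - β) = r * (N : ℝ) ^ (ε - β) := by
        rw [hr, ← Real.mul_rpow (by norm_num) (Nat.cast_nonneg N)]
        push_cast; ring_nf
      rw [h3] at h1
      have h4 := norm_sub_le_norm_sub_add_norm_sub (posSum g (N + d) x) (posSum g (N + N) x)
        (posSum g N x)
      refine h4.trans ((add_le_add h1 h2).trans_eq ?_)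
      rw [← hB]
      field_simp
      ring

lemma continuous_posSum (g : ℝ → ℂ) (N : ℕ) : Continuous (posSum g N) := by
  unfold posSum
  exact continuous_finsetSum _ fun n _ =>
    continuous_const.mul (continuous_e.comp (continuous_const.mul continuous_id))

lemma posSum_periodic (g : ℝ → ℂ) (N : ℕ) : Function.Periodic (posSum g N) 1 := by
  intro t
  refine Finset.sum_congr rfl fun n _ => ?_
  have h := e_int ((n + 1 : ℕ) : ℤ)
  rw [mul_add, mul_one, e_add]
  push_cast at h ⊢
  rw [h, mul_one]

lemma exists_posSum_limit {α : ℝ} (hα0 : 0 < α) (hα1 : α ≤ 1)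
    {g : ℝ → ℂ} (hg : Continuous g) (hp : Function.Periodic g 1)
    (hH : ∀ β : ℝ, 0 < β → β < α → ∃ C > (0:ℝ), ∀ x y : ℝ, ‖g x - g y‖ ≤ C * |x - y| ^ β) :
    ∃ F : ℝ → ℂ, TendstoUniformly (posSum g) F atTop ∧ Continuous F ∧ Function.Periodic F 1 ∧
      ∀ β : ℝ, 0 < β → β < α → ∃ C > (0:ℝ), ∀ x y : ℝ, ‖F x - F y‖ ≤ C * |x - y| ^ β := by
  have tail : ∀ β : ℝ, 0 < β → β < α → ∃ K > 0, ∀ (N : ℕ), 0 < N → ∀ M, N ≤ M → ∀ x,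
      ‖posSum g M x - posSum g N x‖ ≤ K * (N : ℝ) ^ (-β) := by
    intro β hβ hβα
    obtain ⟨C, hC, hCH⟩ := hH ((β + α) / 2) (by linarith) (by linarith)
    have := norm_posSum_tail_le hg hp hC (by linarith) hCH (ε := (α - β) / 2) (by linarith)
      (by linarith) (by linarith)
    rwa [show (α - β) / 2 - (β + α) / 2 = -β by ring] at this
  have small : ∀ K β : ℝ, 0 < β → Tendsto (fun N : ℕ => K * (N : ℝ) ^ (-β)) atTop (nhds 0) := by
    intro K β hβ
    simpa using ((tendsto_rpow_neg_atTop hβ).comp tendsto_natCast_atTop_atTop).const_mul K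
  have hcauchy : ∀ x, CauchySeq fun N => posSum g N x := by
    intro x
    obtain ⟨K, hK, hKt⟩ := tail (α / 2) (by linarith) (by linarith)
    rw [Metric.cauchySeq_iff']
    intro δ hδ
    obtain ⟨N, hN, hN0⟩ :=
      (((small K (α / 2) (by linarith)).eventually_lt_const hδ).and (eventually_gt_atTop 0)).exists
    refine ⟨N, fun M hM => ?_⟩
    rw [dist_eq_norm]
    exact (hKt N hN0 M hM x).trans_lt hN
  choose F hF using fun x => cauchySeq_tendsto_of_complete (hcauchy x)
  have rate : ∀ β : ℝ, 0 < β → β < α → ∃ K > 0, ∀ (N : ℕ), 0 < N → ∀ x,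
      ‖F x - posSum g N x‖ ≤ K * (N : ℝ) ^ (-β) := by
    intro β hβ hβα
    obtain ⟨K, hK, hKt⟩ := tail β hβ hβα
    refine ⟨K, hK, fun N hN x => ?_⟩
    refine le_of_tendsto ((hF x).sub_const _).norm ?_
    filter_upwards [eventually_ge_atTop N] with M hM using hKt N hN M hM x
  have hunif : TendstoUniformly (posSum g) F atTop := by
    obtain ⟨K, hK, hKt⟩ := rate (α / 2) (by linarith) (by linarith)
    rw [Metric.tendstoUniformly_iff]
    intro δ hδ
    filter_upwards [(small K (α / 2) (by linarith)).eventually_lt_const hδ,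
      eventually_gt_atTop 0] with N hN hN0 x
    rw [dist_eq_norm]
    exact (hKt N hN0 x).trans_lt hN
  refine ⟨F, hunif, hunif.continuous (Frequently.of_forall (continuous_posSum g)), ?_, ?_⟩
  · intro x
    refine tendsto_nhds_unique (hF (x + 1)) ?_
    simpa only [posSum_periodic g _ x] using hF x
  intro β hβ hβα
  obtain ⟨K, hK, hKt⟩ := rate β hβ hβα
  obtain ⟨C, hC, hCH⟩ := hH ((β + α) / 2) (by linarith) (by linarith)
  set ε := (α - β) / 2 with hε
  have hε0 : 0 < ε := by linarith
  have hε1 : ε ≤ 1 := by linarith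
  set c₁ := ‖coeff g (0 + 1 : ℕ)‖ with hc₁
  have hc₁0 : 0 ≤ c₁ := norm_nonneg _
  have tri : ∀ (N : ℕ), 0 < N → ∀ x y, ‖F x - F y‖ ≤
      2 * (K * (N : ℝ) ^ (-β)) + ‖posSum g N x - posSum g N y‖ := by
    intro N hN x y
    have e1 : F x - F y = (F x - posSum g N x) - (F y - posSum g N y) +
      (posSum g N x - posSum g N y) := by ring
    rw [e1]
    have t1 := norm_add_le ((F x - posSum g N x) - (F y - posSum g N y))
      (posSum g N x - posSum g N y)
    have t2 := norm_sub_le (F x - posSum g N x) (F y - posSum g N y)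
    have t3 := hKt N hN x
    have t4 := hKt N hN y
    linarith
  refine ⟨2 * K + 2 * c₁ + 4 * C / ε, by positivity, fun x y => ?_⟩
  rcases eq_or_ne x y with rfl | hxy
  · simp [Real.zero_rpow hβ.ne']
  set δ := |x - y| with hδ
  have hδ0 : 0 < δ := abs_pos.2 (sub_ne_zero.2 hxy)
  have hδβ : 0 < δ ^ β := Real.rpow_pos_of_pos hδ0 β
  rcases le_total δ 1 with hδ1 | hδ1
  · set N := ⌈δ⁻¹⌉₊ with hN
    have hN0 : 0 < N := Nat.ceil_pos.2 (by positivity)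
    have hNlow : δ⁻¹ ≤ N := Nat.le_ceil _
    have hone : 1 ≤ δ⁻¹ := (one_le_inv₀ hδ0).2 hδ1
    have hNup : (N : ℝ) ≤ 2 * δ⁻¹ := by
      have := Nat.ceil_lt_add_one (a := δ⁻¹) (by positivity)
      linarith
    have b1 : (N : ℝ) ^ (-β) ≤ δ ^ β := by
      calc (N : ℝ) ^ (-β) ≤ δ⁻¹ ^ (-β) :=
            Real.rpow_le_rpow_of_nonpos (by positivity) hNlow (by linarith)
        _ = δ ^ β := by rw [Real.inv_rpow hδ0.le, Real.rpow_neg hδ0.le, inv_inv]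
    have b2 : (N : ℝ) ^ ε ≤ 2 * δ ^ (-ε) := by
      calc (N : ℝ) ^ ε ≤ (2 * δ⁻¹) ^ ε := by gcongr
        _ = 2 ^ ε * δ ^ (-ε) := by
            rw [Real.mul_rpow (by norm_num) (by positivity), Real.inv_rpow hδ0.le,
              Real.rpow_neg hδ0.le]
        _ ≤ 2 ^ (1:ℝ) * δ ^ (-ε) := by gcongr; norm_num
        _ = _ := by rw [Real.rpow_one]
    have b3 := norm_posSum_sub_posSum_le hg hp hCH hε0 hε1 N x y
    have b4 : C * δ ^ ((β + α) / 2) * (2 / ε * (N : ℝ) ^ ε) ≤ 4 * C / ε * δ ^ β := by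
      calc _ ≤ C * δ ^ ((β + α) / 2) * (2 / ε * (2 * δ ^ (-ε))) := by gcongr
        _ = 4 * C / ε * (δ ^ ((β + α) / 2) * δ ^ (-ε)) := by ring
        _ = _ := by
          rw [← Real.rpow_add hδ0, hε, show (β + α) / 2 + -((α - β) / 2) = β by ring]
    have b5 := mul_le_mul_of_nonneg_left b1 hK.le
    have b6 := tri N hN0 x y
    have b7 : 0 ≤ c₁ * δ ^ β := by positivity
    linarith
  · have b1 := tri 1 one_pos x y
    have b2 : ‖posSum g 1 x - posSum g 1 y‖ ≤ 2 * c₁ := by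
      have : ∀ z, ‖posSum g 1 z‖ = c₁ := fun z => by
        rw [posSum, Finset.sum_range_one, norm_mul, norm_e, mul_one]
      refine (norm_sub_le _ _).trans ?_
      rw [this, this]
      linarith
    have b3 : 1 ≤ δ ^ β := Real.one_le_rpow hδ1 hβ.le
    have b4 : 0 < 4 * C / ε := by positivity
    rw [Nat.cast_one, Real.one_rpow] at b1
    nlinarith

lemma coeff_comp_neg {g : ℝ → ℂ} (hp : Function.Periodic g 1) (n : ℤ) :
    coeff (fun t => g (-t)) n = coeff g (-n) := by
  have hper : Function.Periodic (fun t => g t * e (n * t)) 1 := by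
    intro t
    simp only [hp t, mul_add, e_add, mul_one, e_int]
  have h1 := intervalIntegral.integral_comp_neg (fun t => g t * e (n * t)) (a := 0) (b := 1)
  have h2 := hper.intervalIntegral_add_eq (-1) 0
  rw [neg_add_cancel, zero_add] at h2
  rw [neg_zero, h2] at h1
  simp only [coeff, Int.cast_neg, neg_neg, neg_mul]
  simpa only [mul_neg] using h1

lemma sum_Icc_one_eq_posSum (g : ℝ → ℂ) (N : ℕ) (x : ℝ) :
    ∑ n ∈ Finset.Icc (1:ℤ) (N:ℤ), coeff g n * e ((n : ℝ) * x) = posSum g N x := by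
  symm
  refine Finset.sum_bij (fun n _ => ((n + 1 : ℕ) : ℤ)) ?_ ?_ ?_ ?_
  · intro n hn
    rw [Finset.mem_range] at hn
    rw [Finset.mem_Icc]
    omega
  · intro a _ b _ h
    omega
  · intro b hb
    rw [Finset.mem_Icc] at hb
    exact ⟨(b - 1).toNat, by rw [Finset.mem_range]; omega, by omega⟩
  · intro n _
    rw [Int.cast_natCast]

lemma sum_Icc_neg_eq_posSum {g : ℝ → ℂ} (hp : Function.Periodic g 1) (N : ℕ) (x : ℝ) :
    ∑ n ∈ Finset.Icc (-(N:ℤ)) (-1 : ℤ), coeff g n * e ((n : ℝ) * x)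
      = posSum (fun t => g (-t)) N (-x) := by
  rw [← sum_Icc_one_eq_posSum]
  refine Finset.sum_bij (fun n _ => -n) ?_ ?_ ?_ ?_
  · intro n hn
    rw [Finset.mem_Icc] at hn ⊢
    omega
  · intro a _ b _ h
    omega
  · intro b hb
    rw [Finset.mem_Icc] at hb
    exact ⟨-b, by rw [Finset.mem_Icc]; omega, by omega⟩
  · intro n _
    rw [coeff_comp_neg hp, neg_neg]
    push_cast
    rw [neg_mul_neg]

/-- Theorem 3, implication a) ⇒ b), range 0 < α ≤ 1: splitting a function in
`C^{<α}` into its positive- and negative-frequency parts preserves the Hölder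
class. -/
theorem stmt_18 (α : ℝ) (hα0 : 0 < α) (hα1 : α ≤ 1)
    (f : ℝ → ℂ) (hf : Continuous f) (hper : Function.Periodic f 1)
    (c : ℤ → ℂ)
    (hc : ∀ n : ℤ, c n = ∫ t in (0:ℝ)..1, f t * e (-(n : ℝ) * t))
    (hc0 : c 0 = 0)
    (hHolder : ∀ β : ℝ, 0 < β → β < α → ∃ C > (0:ℝ), ∀ x y : ℝ,
      ‖f x - f y‖ ≤ C * |x - y| ^ β) :
    (∃ fp : ℝ → ℂ,
      TendstoUniformly
        (fun (N : ℕ) x => ∑ n ∈ Finset.Icc (1:ℤ) (N:ℤ), c n * e ((n : ℝ) * x))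
        fp Filter.atTop ∧
      Continuous fp ∧ Function.Periodic fp 1 ∧
      ∀ β : ℝ, 0 < β → β < α → ∃ C > (0:ℝ), ∀ x y : ℝ,
        ‖fp x - fp y‖ ≤ C * |x - y| ^ β) ∧
    (∃ fm : ℝ → ℂ,
      TendstoUniformly
        (fun (N : ℕ) x => ∑ n ∈ Finset.Icc (-(N:ℤ)) (-1 : ℤ), c n * e ((n : ℝ) * x))
        fm Filter.atTop ∧
      Continuous fm ∧ Function.Periodic fm 1 ∧
      ∀ β : ℝ, 0 < β → β < α → ∃ C > (0:ℝ), ∀ x y : ℝ,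
        ‖fm x - fm y‖ ≤ C * |x - y| ^ β) := by
  have hc' : c = coeff f := funext hc
  subst hc'
  refine ⟨?_, ?_⟩
  · simp only [sum_Icc_one_eq_posSum]
    exact exists_posSum_limit hα0 hα1 hf hper hHolder
  · simp only [sum_Icc_neg_eq_posSum hper]
    have hper' : Function.Periodic (fun t => f (-t)) 1 := fun t => by
      have := hper (-t - 1)
      rw [sub_add_cancel] at this
      simp only [this, neg_add']
    have habs : ∀ x y : ℝ, |-x - -y| = |x - y| := fun x y => by
      rw [neg_sub_neg, abs_sub_comm]
    obtain ⟨F, h1, h2, h3, h4⟩ := exists_posSum_limit hα0 hα1 (hf.comp continuous_neg) hper'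
      fun β hβ hβα => by
        obtain ⟨C, hC, h⟩ := hHolder β hβ hβα
        exact ⟨C, hC, fun x y => by rw [← habs]; exact h (-x) (-y)⟩
    refine ⟨fun x => F (-x), h1.comp fun x => -x, h2.comp continuous_neg, fun x => ?_,
      fun β hβ hβα => ?_⟩
    · have := h3 (-x - 1)
      rw [sub_add_cancel] at this
      simp only [this, neg_add']
    · obtain ⟨C, hC, h⟩ := h4 β hβ hβα
      exact ⟨C, hC, fun x y => by rw [← habs]; exact h (-x) (-y)⟩
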